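/- arXiv:2511.11130 — 4 statements merged into one kernel-verified Lean document; each statement's English description precedes it below -/
import Mathlib

section
/- Let x = (i,j) ∈ ℤ², T ≥ 1, and let Q_{{x}}(T) be the probability that the simple random walk started at the origin visits x within the time interval [1,T]; then Q_{{x}}(T) = P(τ_x ≤ T) = Σ_{n=1}^T q_x(n), where τ_x is the first arrival time at x. Moreover, with b_h = Σ_{k=0}^{h} a_{2k}: if i+j is even, then with m = ⌊T/2⌋, Q_{{x}}(T) = Σ_{h=1}^{m} b_{m-h} · p_x(2h); if i+j is odd, then with m = ⌊(T-1)/2⌋, Q_{{x}}(T) = Σ_{h=0}^{m} b_{m-h} · p_x(2h+1). -/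
open Finset Classical

/-- The four unit steps of the simple random walk on `ℤ²`. -/
def D : Finset (ℤ × ℤ) := {(1,0), (-1,0), (0,1), (0,-1)}

/-- Position after `t` steps of the walk started at `x0`, given a step sequence `ω`. -/
def pos {n : ℕ} (x0 : ℤ × ℤ) (ω : Fin n → D) (t : ℕ) : ℤ × ℤ :=
  x0 + ∑ i ∈ Finset.univ.filter (fun i : Fin n => (i : ℕ) < t), ((ω i : ℤ × ℤ))

/-- Probability of an event under the uniform measure on step sequences of length `n`. -/
noncomputable def prob (n : ℕ) (E : (Fin n → D) → Prop) : ℝ :=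
  ((Finset.univ.filter E).card : ℝ) / 4 ^ n

/-- `p x n` : probability that the walk started at the origin is at `x` after `n` steps. -/
noncomputable def p (x : ℤ × ℤ) (n : ℕ) : ℝ :=
  prob n (fun ω => pos 0 ω n = x)

/-- `q x n` : probability that the walk started at the origin first arrives at `x` at step `n`. -/
noncomputable def q (x : ℤ × ℤ) (n : ℕ) : ℝ :=
  prob n (fun ω => pos 0 ω n = x ∧ ∀ t, 1 ≤ t → t < n → pos 0 ω t ≠ x)

/-- `Qpt x T` : probability that the walk started at the origin visits `x` within steps `1,…,T`,
i.e. `P(τ_x ≤ T)` where `τ_x` is the first arrival time at `x`. -/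
noncomputable def Qpt (x : ℤ × ℤ) (T : ℕ) : ℝ :=
  prob T (fun ω => ∃ t, 1 ≤ t ∧ t ≤ T ∧ pos 0 ω t = x)

/-- `a2 k` is the coefficient `a_{2k}`: `a_0 = 1` and for `k ≥ 1`,
`a_{2k} = Σ over compositions (k_1,…,k_j) of k of (-1)^j · p_0(2k_1)⋯p_0(2k_j)`. -/
noncomputable def a2 (k : ℕ) : ℝ :=
  if k = 0 then 1
  else ∑ c : Composition k, (-1 : ℝ) ^ c.length * (c.blocks.map (fun m => p 0 (2 * m))).prod

/-- `b h = Σ_{k=0}^{h} a_{2k}`. -/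
noncomputable def b (h : ℕ) : ℝ := ∑ k ∈ Finset.range (h + 1), a2 k


lemma prob_eq_sum (n : ℕ) (E : (Fin n → D) → Prop) :
    prob n E = (∑ ω : Fin n → D, if E ω then (1:ℝ) else 0) / 4 ^ n := by
  unfold prob
  rw [Finset.sum_boole]

lemma prob_congr {n : ℕ} {E F : (Fin n → D) → Prop} (h : ∀ ω, E ω ↔ F ω) :
    prob n E = prob n F := by
  have : E = F := funext fun ω => propext (h ω)
  rw [this]

lemma card_D : Fintype.card D = 4 := by
  rw [Fintype.card_coe]; decide

lemma card_D_finset : D.card = 4 := by decide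

lemma prob_true (n : ℕ) : prob n (fun _ => True) = 1 := by
  rw [prob_eq_sum]
  simp [card_D_finset]

lemma prob_nonneg (n : ℕ) (E : (Fin n → D) → Prop) : 0 ≤ prob n E := by
  unfold prob; positivity

lemma prob_mono {n : ℕ} {E F : (Fin n → D) → Prop} (h : ∀ ω, E ω → F ω) :
    prob n E ≤ prob n F := by
  unfold prob
  gcongr
  exact h _

lemma prob_append (m k : ℕ) (G : (Fin (m + k) → D) → Prop) (E : (Fin m → D) → Prop)
    (F : (Fin k → D) → Prop) (h : ∀ u v, G (Fin.append u v) ↔ E u ∧ F v) :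
    prob (m + k) G = prob m E * prob k F := by
  rw [prob_eq_sum, prob_eq_sum, prob_eq_sum]
  rw [← (Fin.appendEquiv m k).sum_comp, Fintype.sum_prod_type]
  rw [div_mul_div_comm, ← pow_add, Finset.sum_mul_sum]
  congr 1
  refine Finset.sum_congr rfl fun u _ => Finset.sum_congr rfl fun v _ => ?_
  have : (Fin.appendEquiv m k) (u, v) = Fin.append u v := rfl
  rw [this]
  simp only [h u v]
  by_cases h1 : E u <;> by_cases h2 : F v <;> simp [h1, h2]

lemma pos_eq {n : ℕ} (ω : Fin n → D) (t : ℕ) :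
    pos 0 ω t = ∑ i : Fin n, if (i : ℕ) < t then ((ω i : ℤ × ℤ)) else 0 := by
  unfold pos
  rw [zero_add, Finset.sum_filter]

lemma pos_append_le {m k : ℕ} (u : Fin m → D) (v : Fin k → D) (t : ℕ) (ht : t ≤ m) :
    pos 0 (Fin.append u v) t = pos 0 u t := by
  rw [pos_eq, pos_eq, Fin.sum_univ_add]
  have : ∀ i : Fin k, ¬ (m + (i : ℕ) < t) := fun i => by omega
  simp [this]

lemma pos_append_add {m k : ℕ} (u : Fin m → D) (v : Fin k → D) :
    pos 0 (Fin.append u v) (m + k) = pos 0 u m + pos 0 v k := by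
  rw [pos_eq, pos_eq, pos_eq, Fin.sum_univ_add]
  have : ∀ i : Fin m, (i : ℕ) < m + k := fun i => by omega
  simp [this]

/-- First arrival at `x` at time `t`. -/
def FA (x : ℤ × ℤ) {n : ℕ} (t : ℕ) (ω : Fin n → D) : Prop :=
  pos 0 ω t = x ∧ ∀ s, 1 ≤ s → s < t → pos 0 ω s ≠ x

lemma FA_append (x : ℤ × ℤ) {m k : ℕ} (u : Fin m → D) (v : Fin k → D) :
    FA x m (Fin.append u v) ↔ FA x m u := by
  unfold FA
  rw [pos_append_le u v m le_rfl]
  refine and_congr_right fun _ => ?_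
  refine forall_congr' fun s => forall_congr' fun _ => forall_congr' fun hs => ?_
  rw [pos_append_le u v s hs.le]

lemma prob_FA (x : ℤ × ℤ) (n t : ℕ) (ht : t ≤ n) : prob n (fun ω => FA x t ω) = q x t := by
  obtain ⟨k, rfl⟩ := Nat.exists_eq_add_of_le ht
  rw [prob_append t k _ (fun u => FA x t u) (fun _ => True), prob_true, mul_one]
  · rfl
  · intro u v
    rw [FA_append]; simp

lemma prob_FA_ret (x : ℤ × ℤ) (n t : ℕ) (ht : t ≤ n) :
    prob n (fun ω => FA x t ω ∧ pos 0 ω n = x) = q x t * p 0 (n - t) := by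
  obtain ⟨k, rfl⟩ := Nat.exists_eq_add_of_le ht
  rw [prob_append t k _ (fun u => FA x t u) (fun v => pos 0 v k = 0)]
  · rw [Nat.add_sub_cancel_left]; rfl
  · intro u v
    rw [FA_append, pos_append_add]
    refine and_congr_right fun h => ?_
    rw [h.1]; simp

lemma FA_exists (x : ℤ × ℤ) {n : ℕ} (ω : Fin n → D) (t : ℕ) (h1 : 1 ≤ t) (h : pos 0 ω t = x) :
    ∃ s, 1 ≤ s ∧ s ≤ t ∧ FA x s ω := by
  have hex : ∃ s, 1 ≤ s ∧ pos 0 ω s = x := ⟨t, h1, h⟩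
  refine ⟨Nat.find hex, (Nat.find_spec hex).1, Nat.find_min' hex ⟨h1, h⟩,
    (Nat.find_spec hex).2, fun s hs hlt hx => Nat.find_min hex hlt ⟨hs, hx⟩⟩

lemma FA_unique (x : ℤ × ℤ) {n : ℕ} (ω : Fin n → D) (s t : ℕ) (hs : 1 ≤ s) (ht : 1 ≤ t)
    (h : FA x s ω) (h' : FA x t ω) : s = t := by
  rcases lt_trichotomy s t with hlt | he | hlt
  · exact absurd h.1 (h'.2 s hs hlt)
  · exact he
  · exact absurd h'.1 (h.2 t ht hlt)

lemma prob_decomp (x : ℤ × ℤ) (n : ℕ) (G : (Fin n → D) → Prop)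
    (hG : ∀ ω, G ω → ∃ t, 1 ≤ t ∧ t ≤ n ∧ pos 0 ω t = x) :
    prob n G = ∑ t ∈ Finset.Icc 1 n, prob n (fun ω => FA x t ω ∧ G ω) := by
  simp only [prob_eq_sum]
  rw [← Finset.sum_div, Finset.sum_comm]
  congr 1
  refine Finset.sum_congr rfl fun ω _ => ?_
  by_cases hg : G ω
  · obtain ⟨t, h1, h2, h3⟩ := hG ω hg
    obtain ⟨s, hs1, hs2, hs⟩ := FA_exists x ω t h1 h3
    rw [Finset.sum_eq_single s]
    · simp [hg, hs]
    · intro r hr hne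
      rw [if_neg]
      rintro ⟨h, -⟩
      exact hne (FA_unique x ω r s (Finset.mem_Icc.1 hr).1 hs1 h hs)
    · intro h
      exact absurd (Finset.mem_Icc.2 ⟨hs1, hs2.trans h2⟩) h
  · simp [hg]

lemma Qpt_eq (x : ℤ × ℤ) (T : ℕ) : Qpt x T = ∑ n ∈ Finset.Icc 1 T, q x n := by
  unfold Qpt
  rw [prob_decomp x T _ (fun ω h => h)]
  refine Finset.sum_congr rfl fun t ht => ?_
  rw [Finset.mem_Icc] at ht
  rw [← prob_FA x T t ht.2]
  refine prob_congr fun ω => ⟨fun h => h.1, fun h => ⟨h, t, ht.1, ht.2, h.1⟩⟩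

lemma p_renewal (x : ℤ × ℤ) (n : ℕ) (hn : 1 ≤ n) :
    p x n = ∑ t ∈ Finset.Icc 1 n, q x t * p 0 (n - t) := by
  unfold p
  rw [prob_decomp x n _ (fun ω h => ⟨n, hn, le_rfl, h⟩)]
  refine Finset.sum_congr rfl fun t ht => ?_
  rw [Finset.mem_Icc] at ht
  exact prob_FA_ret x n t ht.2

lemma step_parity (d : D) : ∃ c : ℤ, (d : ℤ × ℤ).1 + (d : ℤ × ℤ).2 = 2 * c + 1 := by
  obtain ⟨d, hd⟩ := d
  simp only [D, Finset.mem_insert, Finset.mem_singleton] at hd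
  rcases hd with rfl | rfl | rfl | rfl
  · exact ⟨0, by simp⟩
  · exact ⟨-1, by simp⟩
  · exact ⟨0, by simp⟩
  · exact ⟨-1, by simp⟩

lemma pos_parity {n : ℕ} (ω : Fin n → D) :
    ∃ c : ℤ, (pos 0 ω n).1 + (pos 0 ω n).2 = 2 * c + n := by
  choose f hf using step_parity
  refine ⟨∑ i, f (ω i), ?_⟩
  rw [pos_eq]
  simp only [Fin.is_lt, if_true, Prod.fst_sum, Prod.snd_sum]
  rw [← Finset.sum_add_distrib, Finset.sum_congr rfl (fun i _ => hf (ω i)),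
    Finset.sum_add_distrib, Finset.mul_sum]
  simp

lemma p_zero_of_parity (x : ℤ × ℤ) (n : ℕ) (h : ¬ Even (x.1 + x.2 + n)) : p x n = 0 := by
  have : p x n = prob n (fun _ => False) := by
    refine prob_congr fun ω => ⟨fun hx => ?_, False.elim⟩
    obtain ⟨c, hc⟩ := pos_parity ω
    rw [hx] at hc
    exact h ⟨c + n, by linarith⟩
  rw [this, prob_eq_sum]; simp

lemma q_zero_of_parity (x : ℤ × ℤ) (n : ℕ) (h : ¬ Even (x.1 + x.2 + n)) : q x n = 0 := by
  refine le_antisymm ?_ (prob_nonneg _ _)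
  rw [← p_zero_of_parity x n h]
  exact prob_mono fun ω h => h.1

lemma p_zero_zero : p 0 0 = 1 := by
  rw [← prob_true 0]
  refine prob_congr fun ω => ?_
  simp [pos_eq]

/-- Weighted sum over all compositions. -/
noncomputable def W (u : ℕ → ℝ) (k : ℕ) : ℝ :=
  ∑ c : Composition k, (-1 : ℝ) ^ c.length * (c.blocks.map u).prod

lemma W_zero (u : ℕ → ℝ) : W u 0 = 1 := by
  unfold W
  rw [Fintype.sum_eq_single (Composition.ones 0)]
  · simp
  · intro c hc
    exact absurd (Composition.ext (by rw [(Composition.blocks_eq_nil c).2 rfl]; simp)) hc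

/-- Prepend a block. -/
def consComp (n : ℕ) (s : Σ k : Fin (n + 1), Composition (n - k)) : Composition (n + 1) where
  blocks := (s.1 + 1 : ℕ) :: s.2.blocks
  blocks_pos := by
    intro i hi
    rcases List.mem_cons.1 hi with h | h
    · omega
    · exact s.2.blocks_pos h
  blocks_sum := by
    rw [List.sum_cons, s.2.blocks_sum]
    have := s.1.2
    omega

lemma consComp_bij (n : ℕ) : Function.Bijective (consComp n) := by
  constructor
  · rintro ⟨k, c⟩ ⟨k', c'⟩ h
    have h' := congrArg Composition.blocks h
    simp only [consComp, List.cons.injEq] at h'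
    obtain ⟨h1, h2⟩ := h'
    have : k = k' := by ext; omega
    subst this
    have : c = c' := Composition.ext h2
    rw [this]
  · intro c
    obtain ⟨bl, hpos, hsum⟩ := c
    cases bl with
    | nil => simp at hsum
    | cons a l =>
      have ha : 0 < a := hpos (by simp)
      rw [List.sum_cons] at hsum
      refine ⟨⟨⟨a - 1, by omega⟩, ⟨l, fun hi => hpos (by simp [hi]), ?_⟩⟩, ?_⟩
      · simp only; omega
      · refine Composition.ext ?_
        simp only [consComp, List.cons.injEq, and_true]
        omega

lemma W_succ (u : ℕ → ℝ) (n : ℕ) :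
    W u (n + 1) = -∑ k ∈ Finset.range (n + 1), u (k + 1) * W u (n - k) := by
  rw [Finset.sum_range (fun k => u (k + 1) * W u (n - k))]
  unfold W
  rw [← (consComp_bij n).sum_comp, Fintype.sum_sigma, ← Finset.sum_neg_distrib]
  refine Finset.sum_congr rfl fun k _ => ?_
  rw [Finset.mul_sum, ← Finset.sum_neg_distrib]
  refine Finset.sum_congr rfl fun c _ => ?_
  simp only [consComp, Composition.length, List.length_cons, List.map_cons, List.prod_cons]
  ring

lemma a2_eq (k : ℕ) : a2 k = W (fun m => p 0 (2 * m)) k := by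
  unfold a2
  split_ifs with h
  · subst h; rw [W_zero]
  · rfl

open PowerSeries in
lemma inv_series : (mk a2 : PowerSeries ℝ) * mk (fun m => p 0 (2 * m)) = 1 := by
  have h2 : a2 = W (fun m => p 0 (2 * m)) := funext a2_eq
  rw [h2]
  set u : ℕ → ℝ := fun m => p 0 (2 * m) with hu
  have hu0 : u 0 = 1 := p_zero_zero
  clear_value u
  rw [mul_comm]
  ext n
  rw [coeff_mul, Finset.Nat.sum_antidiagonal_eq_sum_range_succ_mk]
  simp only [coeff_mk]
  cases n with
  | zero => simp [W_zero, hu0]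
  | succ n =>
    rw [Finset.sum_range_succ']
    simp [W_succ, hu0, coeff_one]

open PowerSeries in
lemma series_inversion (f g : ℕ → ℝ)
    (h : ∀ n, f n = ∑ k ∈ Finset.range (n + 1), g k * p 0 (2 * (n - k))) (m : ℕ) :
    ∑ k ∈ Finset.range (m + 1), g k = ∑ k ∈ Finset.range (m + 1), b (m - k) * f k := by
  have hf : (mk f : PowerSeries ℝ) = mk g * mk (fun m => p 0 (2 * m)) := by
    ext n
    rw [coeff_mul, Finset.Nat.sum_antidiagonal_eq_sum_range_succ_mk]
    simp [h]
  have hb : (mk b : PowerSeries ℝ) = mk a2 * mk (fun _ => (1:ℝ)) := by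
    ext n
    rw [coeff_mul, Finset.Nat.sum_antidiagonal_eq_sum_range_succ_mk]
    simp [b]
  have key : (mk g : PowerSeries ℝ) * mk (fun _ => (1:ℝ)) = mk f * mk b := by
    rw [hf, hb]
    calc (mk g : PowerSeries ℝ) * mk (fun _ => (1:ℝ))
        = mk g * mk (fun _ => (1:ℝ)) * (mk a2 * mk (fun m => p 0 (2 * m))) := by
          rw [inv_series, mul_one]
      _ = _ := by ring
  have := congrArg (coeff m) key
  rw [coeff_mul, coeff_mul, Finset.Nat.sum_antidiagonal_eq_sum_range_succ_mk,
    Finset.Nat.sum_antidiagonal_eq_sum_range_succ_mk] at this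
  simpa [mul_comm] using this

lemma sum_even (F : ℕ → ℝ) (hF : ∀ n, F (2 * n + 1) = 0) (T : ℕ) :
    ∑ n ∈ Finset.range (T + 1), F n = ∑ h ∈ Finset.range (T / 2 + 1), F (2 * h) := by
  induction T with
  | zero => simp
  | succ T ih =>
    rw [Finset.sum_range_succ, ih]
    rcases Nat.even_or_odd' T with ⟨c, rfl | rfl⟩
    · rw [hF, add_zero]
      congr 2; omega
    · have h1 : (2 * c + 1) / 2 = c := by omega
      have h2 : (2 * c + 1 + 1) / 2 = c + 1 := by omega
      rw [h1, h2, Finset.sum_range_succ _ (c + 1)]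
      rfl

/-- `q` with value at time zero removed. -/
noncomputable def q' (x : ℤ × ℤ) (n : ℕ) : ℝ := if n = 0 then 0 else q x n
/-- `p` with value at time zero removed. -/
noncomputable def p' (x : ℤ × ℤ) (n : ℕ) : ℝ := if n = 0 then 0 else p x n

lemma Icc_sum (F : ℕ → ℝ) (h0 : F 0 = 0) (n : ℕ) :
    ∑ t ∈ Finset.Icc 1 n, F t = ∑ t ∈ Finset.range (n + 1), F t := by
  rw [Finset.sum_range_succ', h0, add_zero, Finset.range_eq_Ico,
    Finset.sum_Ico_add' F 0 n 1]
  rfl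

lemma p'_renewal (x : ℤ × ℤ) (n : ℕ) :
    p' x n = ∑ t ∈ Finset.range (n + 1), q' x t * p 0 (n - t) := by
  rw [← Icc_sum _ (by simp [q'])]
  unfold p'
  split_ifs with h
  · subst h; simp
  · rw [p_renewal x n (by omega)]
    refine Finset.sum_congr rfl fun t ht => ?_
    rw [Finset.mem_Icc] at ht
    rw [q', if_neg (by omega)]

lemma Qpt_eq' (x : ℤ × ℤ) (T : ℕ) : Qpt x T = ∑ n ∈ Finset.range (T + 1), q' x n := by
  rw [Qpt_eq, ← Icc_sum _ (by simp [q'])]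
  refine Finset.sum_congr rfl fun t ht => ?_
  rw [Finset.mem_Icc] at ht
  rw [q', if_neg (by omega)]

lemma q'_zero_of_parity (x : ℤ × ℤ) (n : ℕ) (h : ¬ Even (x.1 + x.2 + n)) : q' x n = 0 := by
  unfold q'
  split_ifs
  · rfl
  · exact q_zero_of_parity x n h

lemma even_case (x : ℤ × ℤ) (hx : Even (x.1 + x.2)) (T : ℕ) :
    Qpt x T = ∑ h ∈ Finset.Icc 1 (T / 2), b (T / 2 - h) * p x (2 * h) := by
  have hq : ∀ n, q' x (2 * n + 1) = 0 := fun n => by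
    apply q'_zero_of_parity
    obtain ⟨c, hc⟩ := hx
    rw [hc]
    rintro ⟨d, hd⟩
    push_cast at hd
    omega
  rw [Qpt_eq', sum_even _ hq,
    series_inversion (fun h => p' x (2 * h)) (fun h => q' x (2 * h)), ← Icc_sum _ (by simp [p'])]
  · refine Finset.sum_congr rfl fun t ht => ?_
    rw [Finset.mem_Icc] at ht
    rw [p', if_neg (by omega)]
  · intro n
    rw [p'_renewal, sum_even _ (fun n => by rw [hq, zero_mul])]
    have : 2 * n / 2 = n := by omega
    rw [this]
    refine Finset.sum_congr rfl fun t _ => ?_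
    rw [Nat.mul_sub]

lemma odd_case (x : ℤ × ℤ) (hx : Odd (x.1 + x.2)) (T : ℕ) (hT : 1 ≤ T) :
    Qpt x T = ∑ h ∈ Finset.range ((T - 1) / 2 + 1), b ((T - 1) / 2 - h) * p x (2 * h + 1) := by
  have hq : ∀ n, q' x (2 * n + 1 + 1) = 0 := fun n => by
    apply q'_zero_of_parity
    obtain ⟨c, hc⟩ := hx
    rw [hc]
    rintro ⟨d, hd⟩
    push_cast at hd
    omega
  have hq0 : q' x 0 = 0 := by simp [q']
  obtain ⟨S, rfl⟩ : ∃ S, T = S + 1 := ⟨T - 1, by omega⟩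
  rw [Nat.add_sub_cancel, Qpt_eq', Finset.sum_range_succ', hq0, add_zero,
    sum_even (fun n => q' x (n + 1)) hq,
    series_inversion (fun h => p' x (2 * h + 1)) (fun h => q' x (2 * h + 1))]
  · refine Finset.sum_congr rfl fun t ht => ?_
    rw [p', if_neg (by omega)]
  · intro n
    rw [p'_renewal, Finset.sum_range_succ', hq0, zero_mul, add_zero,
      sum_even (fun k => q' x (k + 1) * p 0 (2 * n + 1 - (k + 1)))
        (fun n => by rw [hq, zero_mul])]
    have : 2 * n / 2 = n := by omega
    rw [this]
    refine Finset.sum_congr rfl fun t _ => ?_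
    rw [Nat.mul_sub, Nat.add_sub_add_right]

theorem stmt3 (i j : ℤ) (T : ℕ) (hT : 1 ≤ T) :
    (Qpt (i, j) T = ∑ n ∈ Finset.Icc 1 T, q (i, j) n) ∧
    (Even (i + j) →
      Qpt (i, j) T = ∑ h ∈ Finset.Icc 1 (T / 2), b (T / 2 - h) * p (i, j) (2 * h)) ∧
    (Odd (i + j) →
      Qpt (i, j) T = ∑ h ∈ Finset.range ((T - 1) / 2 + 1),
        b ((T - 1) / 2 - h) * p (i, j) (2 * h + 1)) := by
  exact ⟨Qpt_eq _ _, fun h => even_case (i, j) h T, fun h => odd_case (i, j) h T hT⟩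
end

section
/- For every h ≥ 0, the coefficient b_h = Σ_{k=0}^{h} a_{2k} is nonnegative, where a_0 = 1 and, for k ≥ 1, a_{2k} = Σ over compositions (k_1,…,k_j) of k of (-1)^j · p_0(2k_1)⋯p_0(2k_j), with p_0(2k) the probability that the simple random walk on ℤ² started at the origin is back at the origin after 2k steps. -/
open Finset Classical

/-- Number of one-dimensional walks of length `n` ending at `x`. -/
def w1 : ℕ → ℤ → ℕ
  | 0, x => if x = 0 then 1 else 0
  | n + 1, x => w1 n (x - 1) + w1 n (x + 1)

lemma w1_neg (n : ℕ) : ∀ x, w1 n (-x) = w1 n x := by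
  induction n with
  | zero => intro x; simp [w1]
  | succ n ih =>
    intro x
    have h1 : -x - 1 = -(x + 1) := by ring
    have h2 : -x + 1 = -(x - 1) := by ring
    rw [w1, w1, h1, h2, ih, ih, add_comm]

lemma w1_mono (n : ℕ) : ∀ x : ℤ, -1 ≤ x → w1 n (x + 2) ≤ w1 n x := by
  induction n with
  | zero => intro x hx; rw [w1, if_neg (by omega)]; exact Nat.zero_le _
  | succ n ih =>
    intro x hx
    rcases eq_or_lt_of_le hx with h | h
    · subst h
      have := w1_neg (n + 1) 1
      norm_num at this ⊢
      omega
    · have h1 := ih (x - 1) (by omega)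
      have h2 := ih (x + 1) (by omega)
      rw [w1, w1]
      have e1 : x - 1 + 2 = x + 2 - 1 := by ring
      have e2 : x + 1 + 2 = x + 2 + 1 := by ring
      rw [e1] at h1
      rw [e2] at h2
      omega

lemma w1_step (n : ℕ) : w1 (n + 2) 0 ≤ 4 * w1 n 0 := by
  have h := w1_mono n 0 (by norm_num)
  have h2 := w1_neg n 2
  simp only [w1]
  norm_num at h h2 ⊢
  omega

lemma sum_D {M : Type*} [AddCommMonoid M] (f : ℤ × ℤ → M) :
    ∑ d : D, f d = f (1,0) + (f (-1,0) + (f (0,1) + f (0,-1))) := by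
  rw [Finset.sum_coe_sort D f]
  unfold D
  rw [Finset.sum_insert (by decide), Finset.sum_insert (by decide),
    Finset.sum_insert (by decide), Finset.sum_singleton]

lemma count_eq (n : ℕ) : ∀ x y : ℤ,
    (∑ ω : Fin n → D, if ∑ i, (ω i : ℤ × ℤ) = (x, y) then 1 else 0)
      = w1 n (x + y) * w1 n (x - y) := by
  induction n with
  | zero =>
    intro x y
    simp only [Finset.univ_unique, Finset.sum_singleton, Finset.univ_eq_empty, Finset.sum_empty, w1]
    by_cases h : x + y = 0 ∧ x - y = 0
    · obtain ⟨rfl, rfl⟩ : x = 0 ∧ y = 0 := by omega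
      simp
      rfl
    · rw [if_neg]
      · by_cases h1 : x + y = 0
        · have : x - y ≠ 0 := fun h2 => h ⟨h1, h2⟩
          simp [this]
        · simp [h1]
      · intro h3
        simp [Prod.ext_iff] at h3
        omega
  | succ n ih =>
    intro x y
    rw [← (Fin.consEquiv (fun _ : Fin (n+1) => D)).sum_comp, Fintype.sum_prod_type]
    have key : ∀ d : D, (∑ ω : Fin n → D,
        if ∑ i, (((Fin.consEquiv (fun _ : Fin (n+1) => D)) (d, ω)) i : ℤ × ℤ) = (x, y)
          then 1 else 0)
        = w1 n (x - (d : ℤ × ℤ).1 + (y - (d : ℤ × ℤ).2))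
          * w1 n (x - (d : ℤ × ℤ).1 - (y - (d : ℤ × ℤ).2)) := by
      intro d
      rw [← ih]
      refine Finset.sum_congr rfl fun ω _ => ?_
      congr 1
      simp only [Fin.consEquiv, Equiv.coe_fn_mk, Fin.sum_univ_succ, Fin.cons_zero, Fin.cons_succ]
      simp only [Prod.ext_iff, Prod.fst_add, Prod.snd_add, eq_iff_iff]
      constructor <;> rintro ⟨h1, h2⟩ <;> constructor <;> linarith
    rw [Finset.sum_congr rfl fun d _ => key d,
      sum_D (fun d => w1 n (x - d.1 + (y - d.2)) * w1 n (x - d.1 - (y - d.2)))]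
    simp only [w1]
    have e1 : x - 1 + (y - 0) = x + y - 1 := by ring
    have e2 : x - 1 - (y - 0) = x - y - 1 := by ring
    have e3 : x - -1 + (y - 0) = x + y + 1 := by ring
    have e4 : x - -1 - (y - 0) = x - y + 1 := by ring
    have e5 : x - 0 + (y - 1) = x + y - 1 := by ring
    have e6 : x - 0 - (y - 1) = x - y + 1 := by ring
    have e7 : x - 0 + (y - -1) = x + y + 1 := by ring
    have e8 : x - 0 - (y - -1) = x - y - 1 := by ring
    rw [e1, e2, e3, e4, e5, e6, e7, e8]
    ring

lemma p_eq (n : ℕ) : p 0 n = (w1 n 0 : ℝ) ^ 2 / 4 ^ n := by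
  have h := count_eq n 0 0
  unfold p prob pos
  congr 1
  rw [← Finset.card_filter] at h
  norm_num at h ⊢
  rw [sq]
  exact_mod_cast h

lemma p_anti (k : ℕ) : p 0 (2 * (k + 1)) ≤ p 0 (2 * k) := by
  rw [p_eq, p_eq]
  have h : (w1 (2 * k + 2) 0 : ℝ) ≤ 4 * w1 (2 * k) 0 := by exact_mod_cast w1_step (2 * k)
  have e : 2 * (k + 1) = 2 * k + 2 := by ring
  rw [e, div_le_div_iff₀ (by positivity) (by positivity), pow_add]
  have h0 : (0 : ℝ) ≤ w1 (2 * k + 2) 0 := by positivity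
  have : (w1 (2 * k + 2) 0 : ℝ) ^ 2 ≤ (4 * w1 (2 * k) 0) ^ 2 := by gcongr
  have h4 : (0 : ℝ) ≤ 4 ^ (2 * k) := by positivity
  nlinarith [mul_le_mul_of_nonneg_right this h4]

lemma p_zero : p 0 (2 * 0) = 1 := by
  rw [p_eq]; simp [w1]

lemma comp_sum (F : List ℕ → ℝ) (n : ℕ) :
    ∑ c : Composition (n + 1), F c.blocks
      = ∑ m : Fin (n + 1), ∑ c : Composition (n - m), F ((m + 1 : ℕ) :: c.blocks) := by
  rw [Finset.univ.sum_sigma' (fun _ => Finset.univ)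
    (fun (m : Fin (n + 1)) (c : Composition (n - m)) => F ((m + 1 : ℕ) :: c.blocks))]
  symm
  refine Finset.sum_bij (fun (x : Σ m : Fin (n + 1), Composition (n - m)) _ =>
    (⟨(x.1 + 1 : ℕ) :: x.2.blocks, ?_, ?_⟩ : Composition (n + 1))) ?_ ?_ ?_ ?_
  · intro i hi
    rcases List.mem_cons.1 hi with h | h
    · omega
    · exact x.2.blocks_pos h
  · have := x.2.blocks_sum
    have := x.1.2
    simp only [List.sum_cons]
    omega
  · intro _ _; simp
  · rintro ⟨m, c⟩ _ ⟨m', c'⟩ _ h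
    simp only [Composition.mk.injEq, List.cons.injEq] at h
    obtain ⟨h1, h2⟩ := h
    obtain rfl : m = m' := Fin.ext (by omega)
    obtain rfl : c = c' := Composition.ext h2
    rfl
  · rintro ⟨l, hl, hs⟩ _
    cases l with
    | nil => simp at hs
    | cons a l =>
      have ha : 0 < a := hl (by simp)
      simp only [List.sum_cons] at hs
      refine ⟨⟨⟨a - 1, by omega⟩, ⟨l, fun hi => hl (List.mem_cons_of_mem _ hi), ?_⟩⟩,
        by simp, ?_⟩
      · simp only; omega
      · apply Composition.ext
        simp only [List.cons.injEq, and_true]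
        omega
  · intro _ _; rfl

/-- The composition sum without the case distinction at `0`. -/
lemma a2_eq_s4 (k : ℕ) : a2 k = ∑ c : Composition k,
    (-1 : ℝ) ^ c.blocks.length * (c.blocks.map (fun m => p 0 (2 * m))).prod := by
  unfold a2
  split_ifs with h
  · subst h
    have hb : ∀ c : Composition 0, c.blocks = [] := fun c => by
      rw [← List.length_eq_zero_iff]
      exact Nat.le_zero.1 c.length_le
    simp [hb, composition_card]
  · rfl

lemma a2_rec (n : ℕ) :
    a2 (n + 1) = - ∑ m ∈ Finset.range (n + 1), p 0 (2 * (m + 1)) * a2 (n - m) := by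
  rw [a2_eq_s4, comp_sum (fun l => (-1 : ℝ) ^ l.length * (l.map (fun m => p 0 (2 * m))).prod),
    Finset.sum_range, ← Finset.sum_neg_distrib]
  refine Finset.sum_congr rfl fun m _ => ?_
  rw [a2_eq_s4, Finset.mul_sum, ← Finset.sum_neg_distrib]
  refine Finset.sum_congr rfl fun c _ => ?_
  simp only [List.length_cons, List.map_cons, List.prod_cons, pow_succ]
  ring

lemma b_zero : b 0 = 1 := by simp [b, a2]

lemma b_succ (n : ℕ) : b (n + 1) = b n + a2 (n + 1) := by
  unfold b; rw [Finset.sum_range_succ]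

lemma conv_one (n : ℕ) : ∑ m ∈ Finset.range (n + 1), p 0 (2 * m) * b (n - m) = 1 := by
  induction n with
  | zero => rw [zero_add, Finset.sum_range_one, p_zero, Nat.sub_zero, b_zero, mul_one]
  | succ n ih =>
    have h : ∑ m ∈ Finset.range (n + 1), p 0 (2 * m) * b (n + 1 - m)
        = ∑ m ∈ Finset.range (n + 1), p 0 (2 * m) * b (n - m)
          + ∑ m ∈ Finset.range (n + 1), p 0 (2 * m) * a2 (n + 1 - m) := by
      rw [← Finset.sum_add_distrib]
      refine Finset.sum_congr rfl fun m hm => ?_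
      have : n + 1 - m = (n - m) + 1 := by have := Finset.mem_range.1 hm; omega
      rw [this, b_succ]; ring
    have h2 : ∑ m ∈ Finset.range (n + 2), p 0 (2 * m) * a2 (n + 1 - m) = 0 := by
      rw [Finset.sum_range_succ', p_zero, Nat.sub_zero, a2_rec]
      simp only [Nat.add_sub_add_right]
      ring
    have h3 : a2 0 = 1 := by simp [a2]
    rw [Finset.sum_range_succ, Nat.sub_self, h3] at h2
    rw [Finset.sum_range_succ, Nat.sub_self, b_zero, h, ih]
    linarith

theorem stmt4 (h : ℕ) : 0 ≤ b h := by
  induction h using Nat.strong_induction_on with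
  | _ h ih =>
    cases h with
    | zero => rw [b_zero]; norm_num
    | succ n =>
      have h1 := conv_one (n + 1)
      rw [Finset.sum_range_succ', p_zero, Nat.sub_zero] at h1
      simp only [Nat.add_sub_add_right] at h1
      have h2 := conv_one n
      have h3 : ∑ m ∈ Finset.range (n + 1), p 0 (2 * (m + 1)) * b (n - m)
          ≤ ∑ m ∈ Finset.range (n + 1), p 0 (2 * m) * b (n - m) :=
        Finset.sum_le_sum fun m _ =>
          mul_le_mul_of_nonneg_right (p_anti m) (ih (n - m) (by omega))
      linarith
end

section
/- Let A = {y_1,…,y_k} ⊆ ℤ² be a set of k ≥ 2 distinct points. Then for every v ∈ {1,…,k} and every n ≥ 1, h_{y_v}^{0}(n | A∖{y_v}) = Σ_{u=1, u≠v}^{k} Σ_{t=1}^{n} g_{y_u}^{0}(t | A∖{y_u}) · h_{y_v}^{y_u}(n-t | A∖{y_u, y_v}). -/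
open Finset Classical

/-- `qFrom x0 x n` : probability that the walk started at `x0` first arrives at `x` at step `n`. -/
noncomputable def qFrom (x0 x : ℤ × ℤ) (n : ℕ) : ℝ :=
  prob n (fun ω => pos x0 ω n = x ∧ ∀ t, 1 ≤ t → t < n → pos x0 ω t ≠ x)

/-- `g x0 y B n` : probability that the walk started at `x0` first reaches `y` at step `n`
without visiting any point of `B` during steps `1,…,n`. -/
noncomputable def g (x0 y : ℤ × ℤ) (B : Finset (ℤ × ℤ)) (n : ℕ) : ℝ :=
  prob n (fun ω => pos x0 ω n = y ∧ (∀ t, 1 ≤ t → t < n → pos x0 ω t ≠ y) ∧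
    (∀ t, 1 ≤ t → t ≤ n → pos x0 ω t ∉ B))

/-- `hW x0 y B n` : probability that the walk started at `x0` first reaches `y` at step `n`
having visited every point of `B` by step `n` (so `hW x0 y ∅ n = qFrom x0 y n`). -/
noncomputable def hW (x0 y : ℤ × ℤ) (B : Finset (ℤ × ℤ)) (n : ℕ) : ℝ :=
  prob n (fun ω => pos x0 ω n = y ∧ (∀ t, 1 ≤ t → t < n → pos x0 ω t ≠ y) ∧
    (∀ s ∈ B, ∃ t, 1 ≤ t ∧ t ≤ n ∧ pos x0 ω t = s))

lemma pos_append_left {m l : ℕ} (x0 : ℤ × ℤ) (a : Fin m → D) (b : Fin l → D) (s : ℕ)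
    (hs : s ≤ m) : pos x0 (Fin.append a b) s = pos x0 a s := by
  unfold pos
  rw [Finset.sum_filter, Finset.sum_filter, Fin.sum_univ_add]
  have h : ∀ i : Fin l, ¬ (m + (i : ℕ) < s) := fun i => by omega
  simp [h]

lemma pos_append_right {m l : ℕ} (x0 : ℤ × ℤ) (a : Fin m → D) (b : Fin l → D) (s : ℕ) :
    pos x0 (Fin.append a b) (m + s) = pos (pos x0 a m) b s := by
  unfold pos
  rw [Finset.sum_filter, Finset.sum_filter, Finset.sum_filter, Fin.sum_univ_add]
  have h : ∀ i : Fin m, (i : ℕ) < m + s := fun i => by omega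
  simp [h, add_assoc]

lemma prob_mul (m l : ℕ) (G : (Fin m → D) → Prop) (H : (Fin l → D) → Prop)
    (F : (Fin (m + l) → D) → Prop)
    (hF : ∀ a b, F (Fin.append a b) ↔ G a ∧ H b) :
    prob (m + l) F = prob m G * prob l H := by
  unfold prob
  have : (Finset.univ.filter F).card
      = ((Finset.univ.filter G) ×ˢ (Finset.univ.filter H)).card := by
    symm
    refine Finset.card_equiv (Fin.appendEquiv m l) ?_
    rintro ⟨a, b⟩
    have := hF a b
    simp [Fin.appendEquiv, this]
  rw [this, Finset.card_product, pow_add]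
  push_cast
  rw [div_mul_div_comm]

/-- the walk enters `A` first at `yu` at time `t`, and then completes the cover, ending at `yv` -/
def splitEvent (yu yv : ℤ × ℤ) (B B' : Finset (ℤ × ℤ)) (t l : ℕ) {n : ℕ}
    (ω : Fin n → D) : Prop :=
  (pos 0 ω t = yu ∧ (∀ s, 1 ≤ s → s < t → pos 0 ω s ≠ yu) ∧
    (∀ s, 1 ≤ s → s ≤ t → pos 0 ω s ∉ B)) ∧
  (pos 0 ω (t + l) = yv ∧ (∀ s, 1 ≤ s → s < l → pos 0 ω (t + s) ≠ yv) ∧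
    (∀ z ∈ B', ∃ r, 1 ≤ r ∧ r ≤ l ∧ pos 0 ω (t + r) = z))

lemma prob_split (yu yv : ℤ × ℤ) (B B' : Finset (ℤ × ℤ)) (t l n : ℕ) (hn : t + l = n) :
    prob n (splitEvent yu yv B B' t l) = g 0 yu B t * hW yu yv B' l := by
  subst hn
  unfold g hW
  apply prob_mul
  intro a b
  unfold splitEvent
  have h1 : ∀ s, s ≤ t → pos 0 (Fin.append a b) s = pos 0 a s :=
    fun s hs => pos_append_left 0 a b s hs
  have h2 : ∀ s, pos 0 (Fin.append a b) (t + s) = pos (pos 0 a t) b s :=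
    fun s => pos_append_right 0 a b s
  have e1 : (pos 0 (Fin.append a b) t = yu ∧
      (∀ s, 1 ≤ s → s < t → pos 0 (Fin.append a b) s ≠ yu) ∧
      (∀ s, 1 ≤ s → s ≤ t → pos 0 (Fin.append a b) s ∉ B)) ↔
      (pos 0 a t = yu ∧ (∀ s, 1 ≤ s → s < t → pos 0 a s ≠ yu) ∧
      (∀ s, 1 ≤ s → s ≤ t → pos 0 a s ∉ B)) := by
    rw [h1 t le_rfl]
    refine and_congr Iff.rfl (and_congr ?_ ?_)
    · exact forall_congr' fun s => forall_congr' fun _ => forall_congr' fun h => by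
        rw [h1 s h.le]
    · exact forall_congr' fun s => forall_congr' fun _ => forall_congr' fun h => by
        rw [h1 s h]
  rw [e1]
  refine and_congr_right fun h => ?_
  simp only [h2, h.1]

lemma prob_union {ι : Type*} (I : Finset ι) (n : ℕ) (E : (Fin n → D) → Prop)
    (F : ι → (Fin n → D) → Prop)
    (hE : ∀ ω, E ω ↔ ∃ i ∈ I, F i ω)
    (hd : ∀ ω, ∀ i ∈ I, ∀ j ∈ I, F i ω → F j ω → i = j) :
    prob n E = ∑ i ∈ I, prob n (F i) := by
  unfold prob
  rw [← Finset.sum_div]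
  congr 1
  rw [← Nat.cast_sum, ← Finset.card_biUnion]
  · congr 2
    ext ω
    simp [hE]
  · intro i hi j hj hij
    rw [Function.onFun, Finset.disjoint_left]
    intro ω h1 h2
    simp only [Finset.mem_filter, Finset.mem_univ, true_and] at h1 h2
    exact hij (hd ω i hi j hj h1 h2)

theorem stmt9 (k : ℕ) (hk : 2 ≤ k) (y : Fin k → ℤ × ℤ) (hy : Function.Injective y)
    (v : Fin k) (n : ℕ) (hn : 1 ≤ n) :
    hW 0 (y v) ((Finset.image y Finset.univ).erase (y v)) n =
      ∑ u ∈ Finset.univ.filter (fun u : Fin k => u ≠ v), ∑ t ∈ Finset.Icc 1 n,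
        g 0 (y u) ((Finset.image y Finset.univ).erase (y u)) t *
          hW (y u) (y v) (((Finset.image y Finset.univ).erase (y u)).erase (y v)) (n - t) := by
  rw [← Finset.sum_product']
  have key : ∀ x ∈ (Finset.univ.filter (fun u : Fin k => u ≠ v)) ×ˢ Finset.Icc 1 n,
      g 0 (y x.1) ((Finset.image y Finset.univ).erase (y x.1)) x.2 *
          hW (y x.1) (y v) (((Finset.image y Finset.univ).erase (y x.1)).erase (y v)) (n - x.2)
      = prob n (splitEvent (y x.1) (y v) ((Finset.image y Finset.univ).erase (y x.1))
          (((Finset.image y Finset.univ).erase (y x.1)).erase (y v)) x.2 (n - x.2)) := by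
    intro x hx
    simp only [Finset.mem_product, Finset.mem_Icc] at hx
    rw [prob_split]
    omega
  rw [Finset.sum_congr rfl key]
  have hne : ∀ a b, y a = y b ↔ a = b := fun a b => hy.eq_iff
  unfold hW
  apply prob_union
  · intro ω
    constructor
    · rintro ⟨hend, hfirst, hvis⟩
      have hex : ∃ t, 1 ≤ t ∧ t ≤ n ∧ ∃ u, pos 0 ω t = y u := ⟨n, hn, le_rfl, v, hend⟩
      obtain ⟨ht1, htn, u, hu⟩ := Nat.find_spec hex
      have hmin : ∀ s, s < Nat.find hex → 1 ≤ s → ∀ w, pos 0 ω s ≠ y w := by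
        intro s hs h1 w hw
        exact Nat.find_min hex hs ⟨h1, by omega, w, hw⟩
      generalize Nat.find hex = t at *
      have huv : u ≠ v := by
        rintro rfl
        have : t = n := by
          by_contra h
          exact hfirst t ht1 (by omega) hu
        subst this
        obtain ⟨w, hw⟩ : ∃ w : Fin k, w ≠ u := by
          haveI : Nontrivial (Fin k) := Fin.nontrivial_iff_two_le.mpr hk
          exact exists_ne u
        obtain ⟨s, hs1, hs2, hs⟩ := hvis (y w) (by simp [hne, hw])
        rcases hs2.lt_or_eq with h | h
        · exact hmin s h hs1 w hs
        · subst h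
          exact hw (hy (hs.symm.trans hu))
      refine ⟨(u, t), by simp [huv, ht1, htn], ⟨hu, fun s h1 h2 => hmin s h2 h1 u, ?_⟩, ?_, ?_, ?_⟩
      · intro s h1 h2 hmem
        simp only [Finset.mem_erase, Finset.mem_image, Finset.mem_univ, true_and] at hmem
        obtain ⟨h3, w, hw⟩ := hmem
        rcases h2.lt_or_eq with h | h
        · exact hmin s h h1 w hw.symm
        · exact h3 (h ▸ hu)
      · show pos 0 ω (t + (n - t)) = _
        rw [Nat.add_sub_cancel' htn]; exact hend
      · intro s h1 h2
        simp only at h2 ⊢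
        exact hfirst (t + s) (by omega) (by omega)
      · intro z hz
        simp only [Finset.mem_erase, Finset.mem_image, Finset.mem_univ, true_and] at hz
        obtain ⟨hz1, hz2, w, rfl⟩ := hz
        obtain ⟨s, hs1, hs2, hs⟩ := hvis (y w) (by simp [hz1])
        have hts : t < s := by
          by_contra h
          rcases (not_lt.mp h).lt_or_eq with h | h
          · exact hmin s h hs1 w hs
          · subst h
            exact hz2 (hs.symm.trans hu)
        refine ⟨s - t, by omega, ?_, ?_⟩
        · simp only; omega
        · simp only
          rw [Nat.add_sub_cancel' hts.le]; exact hs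
    · rintro ⟨⟨u, t⟩, hm, ⟨hu, hu1, hu2⟩, hend, hfirst, hvis⟩
      simp only [Finset.mem_product, Finset.mem_filter, Finset.mem_univ, true_and,
        Finset.mem_Icc] at hm hu hu1 hu2 hend hfirst hvis
      obtain ⟨huv, ht1, htn⟩ := hm
      rw [Nat.add_sub_cancel' htn] at hend
      refine ⟨hend, ?_, ?_⟩
      · intro s h1 h2 hs
        by_cases h : s ≤ t
        · refine hu2 s h1 h ?_
          rw [hs]
          simp [hne, Ne.symm huv]
        · have := hfirst (s - t) (by omega) (by omega)
          rw [Nat.add_sub_cancel' (by omega)] at this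
          exact this hs
      · intro z hz
        by_cases hzu : z = y u
        · exact ⟨t, ht1, htn, hu.trans hzu.symm⟩
        · simp only [Finset.mem_erase] at hz
          obtain ⟨r, h1, h2, h3⟩ := hvis z (by
            simp only [Finset.mem_erase]; exact ⟨hz.1, hzu, hz.2⟩)
          exact ⟨t + r, by omega, by omega, h3⟩
  · rintro ω ⟨u, t⟩ hi ⟨u', t'⟩ hj ⟨⟨a1, a2, a3⟩, -⟩ ⟨⟨b1, b2, b3⟩, -⟩
    simp only [Finset.mem_product, Finset.mem_filter, Finset.mem_univ, true_and,
        Finset.mem_Icc] at hi hj a1 a2 a3 b1 b2 b3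
    have aux : ∀ (u u' : Fin k) (t t' : ℕ), 1 ≤ t → pos 0 ω t = y u →
        (∀ s, 1 ≤ s → s < t' → pos 0 ω s ≠ y u') →
        (∀ s, 1 ≤ s → s ≤ t' → pos 0 ω s ∉ (Finset.image y Finset.univ).erase (y u')) →
        ¬ t < t' := by
      intro u u' t t' h1 hu h2 h3 hlt
      refine h3 t h1 hlt.le ?_
      simp only [Finset.mem_erase]
      exact ⟨h2 t h1 hlt, by rw [hu]; simp⟩
    have e : t = t' := le_antisymm
      (not_lt.mp (aux u' u t' t hj.2.1 b1 a2 a3))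
      (not_lt.mp (aux u u' t t' hi.2.1 a1 b2 b3))
    subst e
    rw [hy (a1.symm.trans b1)]
end

section
/- Let (y_n)_{n≥1}, (x_n)_{n≥1} and (z_n)_{n≥0} be real sequences with z_0 = 1, satisfying the discrete convolution relation y_n = Σ_{k=1}^{n} x_k · z_{n-k} for every n ≥ 1. Then x_1 = y_1 and, for every n > 1, x_n = y_n + Σ_{h=1}^{n-1} ( Σ_{(h_1,…,h_j) composition of h} (-1)^j · z_{h_1}⋯z_{h_j} ) · y_{n-h}, where the inner sum runs over all compositions of h and j denotes the length of the composition. -/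
/-- The signed sum over compositions. -/
noncomputable def compW (z : ℕ → ℝ) (h : ℕ) : ℝ :=
  ∑ c : Composition h, (-1 : ℝ) ^ c.length * (c.blocks.map z).prod

/-- Prepend a block to a composition. -/
def compCons (h : ℕ) (p : Σ i : Fin (h + 1), Composition (h - i)) : Composition (h + 1) where
  blocks := ((p.1 : ℕ) + 1) :: p.2.blocks
  blocks_pos := by
    intro i hi
    rcases List.mem_cons.1 hi with rfl | hi
    · omega
    · exact p.2.blocks_pos hi
  blocks_sum := by
    have := p.1.2
    rw [List.sum_cons, p.2.blocks_sum]
    omega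

theorem compCons_bijective (h : ℕ) : Function.Bijective (compCons h) := by
  constructor
  · rintro ⟨i, c⟩ ⟨j, d⟩ hcd
    have hb := congrArg Composition.blocks hcd
    simp only [compCons, List.cons.injEq] at hb
    obtain ⟨h1, h2⟩ := hb
    have hij : i = j := Fin.ext (by omega)
    subst hij
    have : c = d := Composition.ext h2
    rw [this]
  · rintro ⟨bl, hpos, hsum⟩
    cases bl with
    | nil => simp at hsum
    | cons a l =>
      have ha : 0 < a := hpos (by simp)
      rw [List.sum_cons] at hsum
      refine ⟨⟨⟨a - 1, by omega⟩, ⟨l, fun hi => hpos (List.mem_cons_of_mem _ hi), ?_⟩⟩, ?_⟩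
      · simp only
        omega
      · apply Composition.ext
        simp only [compCons, List.cons.injEq, and_true]
        omega

theorem compW_zero (z : ℕ → ℝ) : compW z 0 = 1 := by
  unfold compW
  rw [Fintype.sum_eq_single (Composition.ones 0)]
  · simp
  · intro c hc
    exact absurd (Subsingleton.elim (h := by
      rw [← Fintype.card_le_one_iff_subsingleton, composition_card]; simp) c _) hc

theorem compW_succ (z : ℕ → ℝ) (h : ℕ) :
    compW z (h + 1) = - ∑ i ∈ Finset.range (h + 1), z (i + 1) * compW z (h - i) := by
  rw [← Fin.sum_univ_eq_sum_range (fun i => z (i + 1) * compW z (h - i))]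
  unfold compW
  rw [← (compCons_bijective h).sum_comp, Fintype.sum_sigma, ← Finset.sum_neg_distrib]
  refine Finset.sum_congr rfl fun i _ => ?_
  rw [Finset.mul_sum, ← Finset.sum_neg_distrib]
  refine Finset.sum_congr rfl fun c _ => ?_
  have : (compCons h ⟨i, c⟩).length = c.length + 1 := by
    simp [← Composition.blocks_length, compCons]
  rw [this]
  simp only [compCons, List.map_cons, List.prod_cons]
  ring

theorem compW_mul (z : ℕ → ℝ) (hz : z 0 = 1) :
    PowerSeries.mk z * PowerSeries.mk (compW z) = 1 := by
  ext n
  rw [PowerSeries.coeff_mul, Finset.Nat.sum_antidiagonal_eq_sum_range_succ_mk]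
  simp only [PowerSeries.coeff_mk, PowerSeries.coeff_one]
  cases n with
  | zero => simp [hz, compW_zero]
  | succ n =>
    rw [Finset.sum_range_succ']
    simp [hz, compW_succ z n]

theorem stmt14 (y x z : ℕ → ℝ) (hz : z 0 = 1)
    (hconv : ∀ n, 1 ≤ n → y n = ∑ k ∈ Finset.Icc 1 n, x k * z (n - k)) :
    x 1 = y 1 ∧
    ∀ n, 1 < n →
      x n = y n + ∑ h ∈ Finset.Icc 1 (n - 1),
        (∑ c : Composition h, (-1 : ℝ) ^ c.length * (c.blocks.map z).prod) * y (n - h) := by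
  refine ⟨by simp [hconv 1 le_rfl, hz], fun n hn => ?_⟩
  -- shifted generating functions
  have hY : PowerSeries.mk (fun n => y (n + 1))
      = PowerSeries.mk (fun n => x (n + 1)) * PowerSeries.mk z := by
    ext m
    rw [PowerSeries.coeff_mul, Finset.Nat.sum_antidiagonal_eq_sum_range_succ_mk]
    simp only [PowerSeries.coeff_mk]
    rw [hconv (m + 1) (by omega), ← Finset.Ico_add_one_right_eq_Icc,
      Finset.sum_Ico_eq_sum_range]
    refine Finset.sum_congr (by simp) fun k _ => ?_
    rw [add_comm 1 k, Nat.add_sub_add_right]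
  have hX : PowerSeries.mk (fun n => x (n + 1))
      = PowerSeries.mk (compW z) * PowerSeries.mk (fun n => y (n + 1)) := by
    rw [hY, mul_comm, mul_assoc, compW_mul z hz, mul_one]
  obtain ⟨m, rfl⟩ : ∃ m, n = m + 1 := ⟨n - 1, by omega⟩
  have := congrArg (PowerSeries.coeff m) hX
  rw [PowerSeries.coeff_mul, Finset.Nat.sum_antidiagonal_eq_sum_range_succ_mk] at this
  simp only [PowerSeries.coeff_mk] at this
  rw [this, Finset.sum_range_succ', compW_zero, add_comm, ← Finset.Ico_add_one_right_eq_Icc,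
      Finset.sum_Ico_eq_sum_range]
  simp only [Nat.sub_zero, one_mul, Nat.add_sub_cancel]
  congr 1
  refine Finset.sum_congr rfl fun k hk => ?_
  have hk := Finset.mem_range.1 hk
  rw [add_comm 1 k, show m - (k + 1) + 1 = m + 1 - (k + 1) by omega]
  rfl
end
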